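/- Let n ≥ 1 be an integer, θ₀ ∈ ℝⁿ, σ² > 0, and let (Σ_N)_{N≥1} be a sequence of symmetric positive definite n×n real matrices with N·Σ_N → σ²·I_n as N → ∞. For each N, let X_N be an ℝⁿ-valued random vector distributed as the multivariate Gaussian with mean θ₀ and covariance matrix Σ_N. Let b : ℝⁿ → ℝⁿ be bounded and continuously differentiable with bounded continuous Jacobian Db. Then lim_{N→∞} N²·( E[‖X_N + (1/N)b(X_N) − θ₀‖₂²] − E[‖X_N − θ₀‖₂²] ) = ‖b(θ₀)‖₂² + 2σ²·Tr(Db(θ₀)). -/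

import Mathlib

open MeasureTheory

/-- The density of the multivariate Gaussian distribution on ℝⁿ with mean `μ`
and (positive definite) covariance matrix `S`, with respect to Lebesgue measure. -/
noncomputable def gaussianDensity {n : ℕ} (μ : EuclideanSpace ℝ (Fin n))
    (S : Matrix (Fin n) (Fin n) ℝ) (x : EuclideanSpace ℝ (Fin n)) : ℝ :=
  Real.sqrt (((2 * Real.pi) ^ n * S.det)⁻¹) *
    Real.exp (-(∑ i, ∑ j, (x i - μ i) * S⁻¹ i j * (x j - μ j)) / 2)


open Filter Topology

/-- centred density, simplified form -/
lemma gd_zero {n : ℕ} (T : Matrix (Fin n) (Fin n) ℝ) (y : EuclideanSpace ℝ (Fin n)) :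
    gaussianDensity 0 T y = Real.sqrt (((2 * Real.pi) ^ n * T.det)⁻¹) *
      Real.exp (-(∑ i, ∑ j, y i * T⁻¹ i j * y j) / 2) := by
  simp [gaussianDensity]

lemma gd_nonneg {n : ℕ} (m) (T : Matrix (Fin n) (Fin n) ℝ) (y : EuclideanSpace ℝ (Fin n)) :
    0 ≤ gaussianDensity m T y := by
  unfold gaussianDensity; positivity

lemma gd_cont {n : ℕ} (m) (T : Matrix (Fin n) (Fin n) ℝ) :
    Continuous (gaussianDensity m T) := by
  unfold gaussianDensity; fun_prop

lemma gd_even {n : ℕ} (T : Matrix (Fin n) (Fin n) ℝ) (y : EuclideanSpace ℝ (Fin n)) :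
    gaussianDensity 0 T (-y) = gaussianDensity 0 T y := by
  simp [gd_zero]

lemma gd_scale {n : ℕ} (m) (S : Matrix (Fin n) (Fin n) ℝ) (hS : S.PosDef) (r : ℝ) (hr : 0 < r)
    (y : EuclideanSpace ℝ (Fin n)) :
    (r⁻¹) ^ n * gaussianDensity m S (m + r⁻¹ • y) = gaussianDensity 0 (r ^ 2 • S) y := by
  rw [gd_zero, gaussianDensity]
  have hdet : IsUnit S.det := hS.det_pos.ne'.isUnit
  have hinv : (r ^ 2 • S)⁻¹ = (r ^ 2)⁻¹ • S⁻¹ := by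
    apply Matrix.inv_eq_left_inv
    rw [Matrix.smul_mul, Matrix.mul_smul, smul_smul, Matrix.nonsing_inv_mul _ hdet,
      inv_mul_cancel₀ (by positivity), one_smul]
  rw [hinv, Matrix.det_smul, ← mul_assoc]
  congr 1
  · rw [← Real.sqrt_sq (show 0 ≤ (r⁻¹) ^ n by positivity), ← Real.sqrt_mul (by positivity)]
    congr 1
    have := hS.det_pos
    simp only [Fintype.card_fin]
    have hr' : r ^ n ≠ 0 := by positivity
    rw [inv_pow, ← pow_mul, mul_comm 2 n, pow_mul]
    field_simp
  · congr 3
    refine Finset.sum_congr rfl fun i _ => Finset.sum_congr rfl fun j _ => ?_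
    simp
    field_simp

lemma law_integral {Ω : Type*} [MeasurableSpace Ω] (P : Measure Ω)
    {n : ℕ} (m : EuclideanSpace ℝ (Fin n)) (S : Matrix (Fin n) (Fin n) ℝ) (hS : S.PosDef)
    (X : Ω → EuclideanSpace ℝ (Fin n)) (hX : AEMeasurable X P)
    (hlaw : P.map X = MeasureTheory.volume.withDensity
      (fun x => ENNReal.ofReal (gaussianDensity m S x))) (r : ℝ) (hr : 0 < r)
    (F : EuclideanSpace ℝ (Fin n) → ℝ) (hF : Continuous F) :
    ∫ ω, F (X ω) ∂P = ∫ y, gaussianDensity 0 (r ^ 2 • S) y * F (m + r⁻¹ • y) := by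
  rw [← integral_map hX hF.aestronglyMeasurable, hlaw,
    integral_withDensity_eq_integral_toReal_smul
      (gd_cont m S).measurable.ennreal_ofReal (by simp)]
  simp only [ENNReal.toReal_ofReal (gd_nonneg _ _ _), smul_eq_mul]
  simp only [← gd_scale m S hS r hr, mul_assoc]
  rw [integral_const_mul]
  rw [Measure.integral_comp_smul volume (fun y => gaussianDensity m S (m + y) * F (m + y)),
    integral_add_left_eq_self (fun y => gaussianDensity m S y * F y) m]
  simp only [finrank_euclideanSpace, Fintype.card_fin, smul_eq_mul]
  rw [abs_of_pos (by positivity)]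
  field_simp

lemma gd_tendsto {n : ℕ} (s : ℝ) (hs : 0 < s) (T : ℕ → Matrix (Fin n) (Fin n) ℝ)
    (hT : Tendsto T atTop (𝓝 (s • 1))) (y : EuclideanSpace ℝ (Fin n)) :
    Tendsto (fun N => gaussianDensity 0 (T N) y) atTop (𝓝 (gaussianDensity 0 (s • 1) y)) := by
  have hinv : Tendsto (fun N => (T N)⁻¹) atTop (𝓝 ((s • (1 : Matrix (Fin n) (Fin n) ℝ))⁻¹)) :=
    (continuousAt_matrix_inv _ (by
      rw [Ring.inverse_eq_inv']
      exact continuousAt_inv₀ (by simp [hs.ne']))).tendsto.comp hT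
  have hdet : Tendsto (fun N => (T N).det) atTop
    (𝓝 ((s • (1 : Matrix (Fin n) (Fin n) ℝ)).det)) :=
    (continuous_id.matrix_det.tendsto _).comp hT
  simp only [gd_zero]
  refine Tendsto.mul ?_ ?_
  · refine (Real.continuous_sqrt.tendsto _).comp (Tendsto.inv₀ (hdet.const_mul _) ?_)
    simp [hs.ne', Real.pi_ne_zero]
  · refine (Real.continuous_exp.tendsto _).comp (Tendsto.div_const (Tendsto.neg ?_) _)
    refine tendsto_finsetSum _ fun i _ => tendsto_finsetSum _ fun j _ => ?_
    exact (tendsto_const_nhds.mul (tendsto_pi_nhds.1 (tendsto_pi_nhds.1 hinv i) j)).mul_const _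

lemma gd_bound {n : ℕ} (hn : 1 ≤ n) (s : ℝ) (hs : 0 < s) (T : ℕ → Matrix (Fin n) (Fin n) ℝ)
    (hT : Tendsto T atTop (𝓝 (s • 1))) :
    ∃ C c : ℝ, 0 < c ∧ 0 ≤ C ∧ ∀ᶠ N in atTop, ∀ y : EuclideanSpace ℝ (Fin n),
      gaussianDensity 0 (T N) y ≤ C * Real.exp (-c * ‖y‖ ^ 2) := by
  have hinv : Tendsto (fun N => (T N)⁻¹) atTop (𝓝 ((s • (1 : Matrix (Fin n) (Fin n) ℝ))⁻¹)) :=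
    (continuousAt_matrix_inv _ (by
      rw [Ring.inverse_eq_inv']
      exact continuousAt_inv₀ (by simp [hs.ne']))).tendsto.comp hT
  have hI : (s • (1 : Matrix (Fin n) (Fin n) ℝ))⁻¹ = s⁻¹ • 1 := by
    apply Matrix.inv_eq_left_inv
    simp [smul_smul, hs.ne']
  rw [hI] at hinv
  have hn0 : (0 : ℝ) < n := by exact_mod_cast hn
  have hdet : Tendsto (fun N => Real.sqrt (((2 * Real.pi) ^ n * (T N).det)⁻¹)) atTop
    (𝓝 (Real.sqrt (((2 * Real.pi) ^ n * (s • (1 : Matrix (Fin n) (Fin n) ℝ)).det)⁻¹))) := by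
    refine (Real.continuous_sqrt.tendsto _).comp (Tendsto.inv₀ (Tendsto.const_mul _ 
      ((continuous_id.matrix_det.tendsto _).comp hT)) ?_)
    simp [hs.ne', Real.pi_ne_zero]
  set D := Real.sqrt (((2 * Real.pi) ^ n * (s • (1 : Matrix (Fin n) (Fin n) ℝ)).det)⁻¹)
  have hD : 0 ≤ D := Real.sqrt_nonneg _
  refine ⟨D + 1, s⁻¹ / 4, by positivity, by positivity, ?_⟩
  have hent : ∀ᶠ N in atTop, ∀ i j, |(T N)⁻¹ i j - (s⁻¹ • (1 : Matrix (Fin n) (Fin n) ℝ)) i j|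
      < s⁻¹ / (2 * n) := by
    rw [eventually_all]; intro i
    rw [eventually_all]; intro j
    have := (tendsto_pi_nhds.1 (tendsto_pi_nhds.1 hinv i) j)
    exact (Metric.tendsto_nhds.1 this) _ (by positivity)
  filter_upwards [hent, hdet.eventually_le_const (show D < D + 1 by linarith)] with N h1 h2 y
  rw [gd_zero]
  refine mul_le_mul h2 (Real.exp_le_exp.2 ?_) (Real.exp_nonneg _) (by positivity)
  have key : ∀ i j, y i * (s⁻¹ • (1 : Matrix (Fin n) (Fin n) ℝ)) i j * y j
      - s⁻¹ / (2 * n) * ((y i ^ 2 + y j ^ 2) / 2) ≤ y i * (T N)⁻¹ i j * y j := by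
    intro i j
    set A := (T N)⁻¹ i j
    set B := (s⁻¹ • (1 : Matrix (Fin n) (Fin n) ℝ)) i j
    have h3 : |y i * (A - B) * y j| ≤ s⁻¹ / (2 * n) * ((y i ^ 2 + y j ^ 2) / 2) := by
      rw [abs_mul, abs_mul]
      have h4 : |y i| * |y j| ≤ (y i ^ 2 + y j ^ 2) / 2 := by
        nlinarith [sq_nonneg (|y i| - |y j|), sq_abs (y i), sq_abs (y j)]
      calc |y i| * |A - B| * |y j| = |A - B| * (|y i| * |y j|) := by ring
        _ ≤ _ := mul_le_mul (h1 i j).le h4 (by positivity) (by positivity)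
    have := (abs_le.1 h3).1
    nlinarith
  have hsum := Finset.sum_le_sum fun i (_ : i ∈ Finset.univ) =>
    Finset.sum_le_sum fun j (_ : j ∈ Finset.univ) => key i j
  have hL : ∑ i, ∑ j, (y i * (s⁻¹ • (1 : Matrix (Fin n) (Fin n) ℝ)) i j * y j
      - s⁻¹ / (2 * n) * ((y i ^ 2 + y j ^ 2) / 2)) = s⁻¹ / 2 * ‖y‖ ^ 2 := by
    rw [EuclideanSpace.real_norm_sq_eq]
    simp only [Finset.sum_sub_distrib, ← Finset.mul_sum, ← Finset.sum_div, Finset.sum_add_distrib,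
      Matrix.smul_apply, Matrix.one_apply]
    simp
    rw [← Finset.mul_sum]
    have : ∑ x, y x * s⁻¹ * y x = s⁻¹ * ∑ i, y i ^ 2 := by
      rw [Finset.mul_sum]; exact Finset.sum_congr rfl fun _ _ => by ring
    rw [this]
    field_simp
    ring
  rw [hL] at hsum
  linarith

lemma bound_integrable {n : ℕ} (c : ℝ) (hc : 0 < c) :
    Integrable (fun y : EuclideanSpace ℝ (Fin n) => (1 + ‖y‖ ^ 2) * Real.exp (-c * ‖y‖ ^ 2)) := by
  have h0 : ∀ d : ℝ, 0 < d →
      Integrable (fun y : EuclideanSpace ℝ (Fin n) => Real.exp (-d * ‖y‖ ^ 2)) := by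
    intro d hd
    have := (GaussianFourier.integrable_cexp_neg_mul_sq_norm_add (V := EuclideanSpace ℝ (Fin n))
      (b := (d : ℂ)) (by simpa using hd) 0 0).re
    refine this.congr (Eventually.of_forall fun y => ?_)
    simp only [zero_mul, add_zero]
    rw [← Complex.ofReal_neg, ← Complex.ofReal_pow, ← Complex.ofReal_mul, ← Complex.ofReal_exp]
    exact Complex.ofReal_re _
  refine Integrable.mono' ((h0 (c / 2) (by positivity)).const_mul (1 + 2 / c)) ?_ ?_
  · exact (by fun_prop : Continuous _).aestronglyMeasurable
  · refine Eventually.of_forall fun y => ?_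
    rw [Real.norm_of_nonneg (by positivity)]
    set t := ‖y‖ ^ 2
    have ht : 0 ≤ t := by positivity
    have h1 : Real.exp (-c * t) = Real.exp (-(c * t / 2)) * Real.exp (-(c / 2) * t) := by
      rw [← Real.exp_add]; congr 1; ring
    rw [h1, ← mul_assoc]
    refine mul_le_mul_of_nonneg_right ?_ (Real.exp_nonneg _)
    rw [Real.exp_neg, ← div_eq_mul_inv, div_le_iff₀ (Real.exp_pos _)]
    have h2 := Real.add_one_le_exp (c * t / 2)
    have h3 : (1 + 2 / c) * (c * t / 2 + 1) ≤ (1 + 2 / c) * Real.exp (c * t / 2) :=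
      mul_le_mul_of_nonneg_left h2 (by positivity)
    refine le_trans ?_ h3
    have : (1 + 2 / c) * (c * t / 2 + 1) = c * t / 2 + 1 + t + 2 / c := by
      field_simp; ring
    rw [this]
    have : 0 ≤ c * t / 2 + 2 / c := by positivity
    linarith

open ProbabilityTheory in
lemma moments {n : ℕ} (s : ℝ) (hs : 0 < s) :
    (∫ y : EuclideanSpace ℝ (Fin n), gaussianDensity 0 (s • 1) y = 1) ∧
    ∀ i j, ∫ y : EuclideanSpace ℝ (Fin n), gaussianDensity 0 (s • 1) y * (y i * y j)
      = if i = j then s else 0 := by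
  set v : NNReal := ⟨s, hs.le⟩ with hv
  have hv0 : v ≠ 0 := by
    intro h; exact hs.ne' (congrArg NNReal.toReal h)
  have hI : (s • (1 : Matrix (Fin n) (Fin n) ℝ))⁻¹ = s⁻¹ • 1 := by
    apply Matrix.inv_eq_left_inv
    simp [smul_smul, hs.ne']
  have hprod : ∀ y : EuclideanSpace ℝ (Fin n), gaussianDensity 0 (s • 1) y
      = ∏ k, gaussianPDFReal 0 v (y k) := by
    intro y
    rw [gd_zero, hI]
    simp only [gaussianPDFReal, Finset.prod_mul_distrib, ← Real.exp_sum, sub_zero]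
    congr 1
    · rw [Finset.prod_const, Matrix.det_smul]
      simp only [Matrix.det_one, mul_one, Fintype.card_fin, Finset.card_univ]
      rw [← mul_pow, Real.sqrt_inv, inv_pow]
      congr 1
      have h2 : (0 : ℝ) ≤ 2 * Real.pi * s := by positivity
      change √((2 * Real.pi * s) ^ n) = √(2 * Real.pi * s) ^ n
      rw [Real.sqrt_eq_iff_mul_self_eq (by positivity) (by positivity), ← mul_pow,
        Real.mul_self_sqrt h2]
    · congr 1
      simp only [Matrix.smul_apply, Matrix.one_apply]
      simp
      rw [neg_div, Finset.sum_div, ← Finset.sum_neg_distrib]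
      refine Finset.sum_congr rfl fun i _ => ?_
      change _ = - y i ^ 2 / (2 * s)
      field_simp
  have hInt : ∀ f : Fin n → ℝ → ℝ, ∫ y : EuclideanSpace ℝ (Fin n), ∏ k, f k (y k)
      = ∏ k, ∫ x, f k x := by
    intro f
    rw [← integral_fintype_prod_volume_eq_prod]
    exact (EuclideanSpace.volume_preserving_symm_measurableEquiv_toLp (Fin n)).integral_comp
      (MeasurableEquiv.measurableEmbedding _) (fun y : Fin n → ℝ => ∏ k, f k (y k))
  have e0 : ∫ x, gaussianPDFReal 0 v x = 1 := integral_gaussianPDFReal_eq_one 0 hv0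
  have e1 : ∫ x, gaussianPDFReal 0 v x * x = 0 := by
    have := integral_id_gaussianReal (μ := 0) (v := v)
    rwa [integral_gaussianReal_eq_integral_smul hv0] at this
  have e2 : ∫ x, gaussianPDFReal 0 v x * (x * x) = s := by
    have := variance_fun_id_gaussianReal (μ := 0) (v := v)
    rw [variance_eq_integral (by fun_prop), integral_id_gaussianReal,
      integral_gaussianReal_eq_integral_smul hv0] at this
    simp only [sub_zero, smul_eq_mul, pow_two] at this
    exact this
  constructor
  · simp only [hprod]
    rw [hInt fun _ => gaussianPDFReal 0 v]
    simp [e0]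
  · intro i j
    have : ∀ y : EuclideanSpace ℝ (Fin n), gaussianDensity 0 (s • 1) y * (y i * y j)
      = ∏ k, (gaussianPDFReal 0 v (y k) *
        ((if k = i then y k else 1) * (if k = j then y k else 1))) := by
      intro y
      rw [hprod, Finset.prod_mul_distrib, Finset.prod_mul_distrib]
      simp
    simp only [this]
    rw [hInt fun k x => gaussianPDFReal 0 v x *
        ((if k = i then x else 1) * (if k = j then x else 1))]
    split_ifs with hij
    · subst hij
      rw [Finset.prod_eq_single i]
      · simpa using e2
      · intro k _ hk
        simpa [hk] using e0
      · simp
    · apply Finset.prod_eq_zero (Finset.mem_univ i)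
      simpa [hij] using e1

lemma gd_integrable {n : ℕ} (T : Matrix (Fin n) (Fin n) ℝ) (C c : ℝ) (hc : 0 < c)
    (hT : ∀ y : EuclideanSpace ℝ (Fin n),
      gaussianDensity 0 T y ≤ C * Real.exp (-c * ‖y‖ ^ 2))
    (F : EuclideanSpace ℝ (Fin n) → ℝ) (hF : Continuous F) (K : ℝ)
    (hK : ∀ y, |F y| ≤ K * (1 + ‖y‖ ^ 2)) :
    Integrable (fun y => gaussianDensity 0 T y * F y) := by
  refine Integrable.mono' ((bound_integrable c hc).const_mul (C * K))
    ((gd_cont 0 T).mul hF).aestronglyMeasurable (Eventually.of_forall fun y => ?_)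
  rw [norm_mul, Real.norm_of_nonneg (gd_nonneg _ _ _), Real.norm_eq_abs]
  calc _ ≤ (C * Real.exp (-c * ‖y‖ ^ 2)) * (K * (1 + ‖y‖ ^ 2)) :=
        mul_le_mul (hT y) (hK y) (abs_nonneg _) ((gd_nonneg 0 T y).trans (hT y))
    _ = _ := by ring

lemma limit_value {n : ℕ} (hn : 1 ≤ n) (s : ℝ) (hs : 0 < s) (a : ℝ)
    (L : EuclideanSpace ℝ (Fin n) →L[ℝ] EuclideanSpace ℝ (Fin n)) :
    ∫ y : EuclideanSpace ℝ (Fin n), gaussianDensity 0 (s • 1) y * (a + 2 * inner ℝ y (L y))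
      = a + 2 * s * ∑ i, L (EuclideanSpace.single i 1) i := by
  obtain ⟨C, c, hc, hC, hev⟩ := gd_bound (n := n) hn s hs (fun _ => s • 1) tendsto_const_nhds
  obtain ⟨N, hT⟩ := hev.exists
  obtain ⟨m0, m2⟩ := moments (n := n) s hs
  have hexp : ∀ y : EuclideanSpace ℝ (Fin n), inner ℝ y (L y)
      = ∑ i, ∑ j, (L (EuclideanSpace.single j 1) i) * (y i * y j) := by
    intro y
    have hy : y = ∑ j, y j • EuclideanSpace.single j (1 : ℝ) := by
      ext k; simp [Finset.sum_apply, Pi.single_apply]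
    have hL : ∀ i, L y i = ∑ j, y j * L (EuclideanSpace.single j 1) i := by
      intro i
      conv_lhs => rw [hy, map_sum]
      simp
    simp only [PiLp.inner_apply, hL]
    refine Finset.sum_congr rfl fun i _ => ?_
    simp only [RCLike.inner_apply, conj_trivial, Finset.sum_mul]
    refine Finset.sum_congr rfl fun j _ => ?_
    ring
  have hInt : ∀ i j, Integrable (fun y : EuclideanSpace ℝ (Fin n) =>
      gaussianDensity 0 (s • 1) y * (y i * y j)) := by
    intro i j
    refine gd_integrable _ C c hc hT _ (by fun_prop) 1 fun y => ?_
    rw [abs_mul]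
    have h1 : |y i| ≤ ‖y‖ := PiLp.norm_apply_le y i
    have h2 : |y j| ≤ ‖y‖ := PiLp.norm_apply_le y j
    nlinarith [abs_nonneg (y i), abs_nonneg (y j), norm_nonneg y]
  have hInt0 : Integrable (fun y : EuclideanSpace ℝ (Fin n) => gaussianDensity 0 (s • 1) y) := by
    simpa using gd_integrable _ C c hc hT (fun _ => 1) (by fun_prop) 1
      fun y => by simp
  have hrw : ∀ y : EuclideanSpace ℝ (Fin n),
      gaussianDensity 0 (s • 1) y * (a + 2 * inner ℝ y (L y))
      = a * gaussianDensity 0 (s • 1) y + ∑ i, ∑ j, (2 * L (EuclideanSpace.single j 1) i) *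
        (gaussianDensity 0 (s • 1) y * (y i * y j)) := by
    intro y
    rw [hexp, mul_add, mul_comm a]
    congr 1
    simp only [Finset.mul_sum]
    refine Finset.sum_congr rfl fun i _ => Finset.sum_congr rfl fun j _ => ?_
    ring
  simp only [hrw]
  rw [integral_add (hInt0.const_mul a)
    (integrable_finsetSum _ fun i _ => integrable_finsetSum _ fun j _ => (hInt i j).const_mul _),
    integral_const_mul, m0, integral_finsetSum _
    fun i _ => integrable_finsetSum _ fun j _ => (hInt i j).const_mul _]
  simp only [integral_finsetSum _ fun j _ => (hInt _ j).const_mul _, integral_const_mul, m2]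
  simp [Finset.mul_sum]
  refine Finset.sum_congr rfl fun i _ => ?_
  ring

theorem stmt13 {Ω : Type*} [MeasurableSpace Ω] (P : Measure Ω) [IsProbabilityMeasure P]
    (n : ℕ) (hn : 1 ≤ n) (θ₀ : EuclideanSpace ℝ (Fin n)) (σ2 : ℝ) (hσ2 : 0 < σ2)
    (Smat : ℕ → Matrix (Fin n) (Fin n) ℝ)
    (hsymm : ∀ N, (Smat N).IsSymm) (hpos : ∀ N, (Smat N).PosDef)
    (hconv : Filter.Tendsto (fun N : ℕ => (N : ℝ) • Smat N) Filter.atTop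
      (nhds (σ2 • (1 : Matrix (Fin n) (Fin n) ℝ))))
    (X : ℕ → Ω → EuclideanSpace ℝ (Fin n))
    (hmeas : ∀ N, AEMeasurable (X N) P)
    (hlaw : ∀ N, P.map (X N) = MeasureTheory.volume.withDensity
      (fun x => ENNReal.ofReal (gaussianDensity θ₀ (Smat N) x)))
    (b : EuclideanSpace ℝ (Fin n) → EuclideanSpace ℝ (Fin n))
    (hb : ContDiff ℝ 1 b) (hbBdd : ∃ M, ∀ x, ‖b x‖ ≤ M)
    (hDbBdd : ∃ M, ∀ x, ‖fderiv ℝ b x‖ ≤ M) :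
    Filter.Tendsto (fun N : ℕ =>
        (N : ℝ) ^ 2 * ((∫ ω, ‖X N ω + (N : ℝ)⁻¹ • b (X N ω) - θ₀‖ ^ 2 ∂P)
          - ∫ ω, ‖X N ω - θ₀‖ ^ 2 ∂P))
      Filter.atTop
      (nhds (‖b θ₀‖ ^ 2
        + 2 * σ2 * ∑ i, fderiv ℝ b θ₀ (EuclideanSpace.single i 1) i)) := by
  obtain ⟨M, hM⟩ := hbBdd
  obtain ⟨D, hD⟩ := hDbBdd
  have hM0 : 0 ≤ M := (norm_nonneg _).trans (hM 0)
  have hD0 : 0 ≤ D := (norm_nonneg _).trans (hD 0)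
  have hbc : Continuous b := hb.continuous
  have hbd : Differentiable ℝ b := hb.differentiable (by norm_num)
  have hlip : ∀ x y, ‖b y - b x‖ ≤ D * ‖y - x‖ := fun x y =>
    convex_univ.norm_image_sub_le_of_norm_fderiv_le (𝕜 := ℝ)
      (fun z _ => hbd z) (fun z _ => hD z) (Set.mem_univ x) (Set.mem_univ y)
  obtain ⟨C, c, hc, hC, hev⟩ := gd_bound hn σ2 hσ2 _ hconv
  rw [← limit_value hn σ2 hσ2]
  set r : ℕ → ℝ := fun N => Real.sqrt N with hr
  have hrtop : Tendsto (fun N => ‖r N‖) atTop atTop := by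
    simp only [hr, Real.norm_of_nonneg (Real.sqrt_nonneg _)]
    exact Real.tendsto_sqrt_atTop.comp tendsto_natCast_atTop_atTop
  set H : ℕ → EuclideanSpace ℝ (Fin n) → ℝ := fun N y =>
    ‖b (θ₀ + (r N)⁻¹ • y)‖ ^ 2 + 2 * inner ℝ y (r N • (b (θ₀ + (r N)⁻¹ • y) - b θ₀)) with hH
  have hHc : ∀ N, Continuous (H N) := fun N => by simp only [hH]; fun_prop
  have hHb : ∀ N, 1 ≤ N → ∀ y, |H N y| ≤ (M ^ 2 + 2 * D) * (1 + ‖y‖ ^ 2) := by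
    intro N hN y
    have hrp : 0 < r N := Real.sqrt_pos.2 (by exact_mod_cast hN)
    have h1 : ‖b (θ₀ + (r N)⁻¹ • y)‖ ^ 2 ≤ M ^ 2 := by
      gcongr; exact hM _
    have h2 : ‖r N • (b (θ₀ + (r N)⁻¹ • y) - b θ₀)‖ ≤ D * ‖y‖ := by
      rw [norm_smul, Real.norm_of_nonneg hrp.le]
      have := hlip θ₀ (θ₀ + (r N)⁻¹ • y)
      rw [add_sub_cancel_left, norm_smul, norm_inv, Real.norm_of_nonneg hrp.le] at this
      calc _ ≤ r N * (D * ((r N)⁻¹ * ‖y‖)) := by gcongr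
        _ = D * ‖y‖ := by field_simp
    have h3 := abs_real_inner_le_norm y (r N • (b (θ₀ + (r N)⁻¹ • y) - b θ₀))
    have h4 : |inner ℝ y (r N • (b (θ₀ + (r N)⁻¹ • y) - b θ₀))| ≤ D * ‖y‖ ^ 2 :=
      h3.trans (by nlinarith [norm_nonneg y])
    have h5 : 0 ≤ M ^ 2 * ‖y‖ ^ 2 := by positivity
    have h6 := abs_le.1 h4
    have h7 := sq_nonneg ‖b (θ₀ + (r N)⁻¹ • y)‖
    have h8 := sq_nonneg M
    simp only [hH]
    rw [abs_le]
    constructor <;> nlinarith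
  have main : Tendsto (fun N : ℕ => ∫ y, gaussianDensity 0 ((N : ℝ) • Smat N) y * H N y) atTop
      (𝓝 (∫ y : EuclideanSpace ℝ (Fin n), gaussianDensity 0 (σ2 • 1) y *
        (‖b θ₀‖ ^ 2 + 2 * inner ℝ y (fderiv ℝ b θ₀ y)))) := by
    refine tendsto_integral_filter_of_dominated_convergence
      (fun y => C * (M ^ 2 + 2 * D) * ((1 + ‖y‖ ^ 2) * Real.exp (-c * ‖y‖ ^ 2))) ?_ ?_ ?_ ?_
    · exact Eventually.of_forall fun N => ((gd_cont _ _).mul (hHc N)).aestronglyMeasurable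
    · filter_upwards [hev, eventually_ge_atTop 1] with N h1 hN
      refine Eventually.of_forall fun y => ?_
      rw [norm_mul, Real.norm_of_nonneg (gd_nonneg _ _ _), Real.norm_eq_abs]
      calc _ ≤ (C * Real.exp (-c * ‖y‖ ^ 2)) * ((M ^ 2 + 2 * D) * (1 + ‖y‖ ^ 2)) :=
            mul_le_mul (h1 y) (hHb N hN y) (abs_nonneg _) ((gd_nonneg 0 _ y).trans (h1 y))
        _ = _ := by ring
    · exact (bound_integrable c hc).const_mul _
    · refine Eventually.of_forall fun y => ?_
      refine (gd_tendsto σ2 hσ2 _ hconv y).mul ?_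
      have hl := (hbd θ₀).hasFDerivAt.lim y hrtop
      have hx : Tendsto (fun N => θ₀ + (r N)⁻¹ • y) atTop (𝓝 θ₀) := by
        have : Tendsto (fun N => (r N)⁻¹) atTop (𝓝 0) :=
          (Real.tendsto_sqrt_atTop.comp tendsto_natCast_atTop_atTop).inv_tendsto_atTop
        simpa using tendsto_const_nhds.add (this.smul_const y)
      exact ((((hbc.tendsto θ₀).comp hx).norm).pow 2).add
        ((tendsto_const_nhds.inner hl).const_mul 2)
  refine main.congr' ?_
  filter_upwards [hev, eventually_ge_atTop 1] with N hT hN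
  have hrp : 0 < r N := Real.sqrt_pos.2 (by exact_mod_cast hN)
  have hr2 : (N : ℝ) = r N ^ 2 := (Real.sq_sqrt (by positivity)).symm
  rw [law_integral P θ₀ (Smat N) (hpos N) (X N) (hmeas N) (hlaw N) (r N) hrp
      (fun x => ‖x + (N : ℝ)⁻¹ • b x - θ₀‖ ^ 2) (by fun_prop),
    law_integral P θ₀ (Smat N) (hpos N) (X N) (hmeas N) (hlaw N) (r N) hrp
      (fun x => ‖x - θ₀‖ ^ 2) (by fun_prop), ← hr2]
  set T := (N : ℝ) • Smat N
  -- the odd part integrates to zero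
  have hodd : ∫ y, gaussianDensity 0 T y * (2 * inner ℝ y (r N • b θ₀)) = 0 := by
    have h := integral_neg_eq_self
      (fun y => gaussianDensity 0 T y * (2 * inner ℝ y (r N • b θ₀))) volume
    simp only [gd_even, inner_neg_left, mul_neg, integral_neg] at h
    linarith
  have hnorm1 : ∀ y : EuclideanSpace ℝ (Fin n), ‖y‖ ≤ 1 + ‖y‖ ^ 2 := fun y => by
    nlinarith [sq_nonneg (‖y‖ - 1), norm_nonneg y]
  have hiH := gd_integrable T C c hc hT (H N) (hHc N) _ (hHb N hN)
  have hiO := gd_integrable T C c hc hT (fun y => 2 * inner ℝ y (r N • b θ₀)) (by fun_prop)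
    (2 * ‖r N • b θ₀‖) (fun y => by
      rw [abs_mul, abs_two]
      have h1 := abs_real_inner_le_norm y (r N • b θ₀)
      have h2 := mul_le_mul_of_nonneg_right (hnorm1 y) (norm_nonneg (r N • b θ₀))
      linarith)
  have hi2 := gd_integrable T C c hc hT (fun y => ‖θ₀ + (r N)⁻¹ • y - θ₀‖ ^ 2) (by fun_prop)
    ((r N)⁻¹ ^ 2) (fun y => by
      rw [add_sub_cancel_left, norm_smul, mul_pow, norm_inv, Real.norm_of_nonneg hrp.le,
        abs_of_nonneg (by positivity)]
      gcongr
      linarith)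
  have hpt : ∀ y, gaussianDensity 0 T y *
      ‖θ₀ + (r N)⁻¹ • y + (N : ℝ)⁻¹ • b (θ₀ + (r N)⁻¹ • y) - θ₀‖ ^ 2
      = gaussianDensity 0 T y * ‖θ₀ + (r N)⁻¹ • y - θ₀‖ ^ 2
        + ((N : ℝ) ^ 2)⁻¹ * (gaussianDensity 0 T y * H N y
          + gaussianDensity 0 T y * (2 * inner ℝ y (r N • b θ₀))) := by
    intro y
    have e1 : θ₀ + (r N)⁻¹ • y + (N : ℝ)⁻¹ • b (θ₀ + (r N)⁻¹ • y) - θ₀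
      = (r N)⁻¹ • y + (N : ℝ)⁻¹ • b (θ₀ + (r N)⁻¹ • y) := by abel
    rw [e1, add_sub_cancel_left, norm_add_sq_real]
    simp only [hH, inner_smul_left, inner_smul_right, inner_sub_right, norm_smul, mul_pow,
      norm_inv, Real.norm_of_nonneg hrp.le, hr2, norm_pow, conj_trivial]
    field_simp
    ring
  simp only [hpt]
  have hi3 : Integrable (fun y => ((N : ℝ) ^ 2)⁻¹ * (gaussianDensity 0 T y * H N y
      + gaussianDensity 0 T y * (2 * inner ℝ y (r N • b θ₀)))) := (hiH.add hiO).const_mul _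
  rw [integral_add hi2 hi3, integral_const_mul, integral_add hiH hiO, hodd]
  have : (N : ℝ) ≠ 0 := by rw [hr2]; positivity
  field_simp
  ring
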